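/- Foster–Lyapunov stability: let X(t) be an irreducible continuous-time Markov chain on ℕ^K with bounded total jump rates, transition rates λ_k > 0 from x to x+e_k and μ_k(x) from x to x−e_k (when x_k > 0) with 0 ≤ μ_k(x) ≤ C. If there exist a function F : ℕ^K → ℝ_{≥0}, δ > 0, and a finite set S ⊆ ℕ^K such that the drift ΔF(x) = Σ_k λ_k(F(x+e_k) − F(x)) + Σ_{k:x_k>0} μ_k(x)(F(x−e_k) − F(x)) satisfies ΔF(x) ≤ −δ for all x ∉ S, then the chain is positive recurrent (ergodic). -/

import Mathlib

open Finset

section StationaryDistribution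

open Filter Topology

variable {α : Type*}

/-- The Cesàro averages of a sequence of subprobability measures converge pointwise, along some
ultrafilter, to a subprobability measure. -/
theorem exists_tendsto_cesaro (q : ℕ → α → ℝ) (hq0 : ∀ n x, 0 ≤ q n x)
    (hqsum : ∀ n (u : Finset α), ∑ x ∈ u, q n x ≤ 1) :
    ∃ (𝒰 : Ultrafilter ℕ) (π : α → ℝ), (𝒰 : Filter ℕ) ≤ atTop ∧
      Tendsto (fun n : ℕ => (n : ℝ)⁻¹ • ∑ i ∈ range n, q i) 𝒰 (𝓝 π) ∧
      (∀ x, 0 ≤ π x) ∧ Summable π := by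
  set ν : ℕ → α → ℝ := fun n => (n : ℝ)⁻¹ • ∑ i ∈ range n, q i with hν
  have hν_apply (n : ℕ) (x : α) : ν n x = (n : ℝ)⁻¹ * ∑ i ∈ range n, q i x := by
    simp [hν]
  have hν0 (n : ℕ) (x : α) : 0 ≤ ν n x := by
    rw [hν_apply]
    exact mul_nonneg (by positivity) (sum_nonneg fun i _ => hq0 i x)
  have hνsum (n : ℕ) (u : Finset α) : ∑ x ∈ u, ν n x ≤ 1 := by
    simp only [hν_apply, ← mul_sum]
    rw [sum_comm]
    calc (n : ℝ)⁻¹ * ∑ i ∈ range n, ∑ x ∈ u, q i x ≤ (n : ℝ)⁻¹ * ∑ i ∈ range n, 1 := by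
          gcongr with i; exact hqsum i u
      _ ≤ 1 := by simpa using inv_mul_le_one
  have hνmem (n : ℕ) : ν n ∈ Set.pi Set.univ fun _ : α => Set.Icc (0 : ℝ) 1 :=
    fun x _ => ⟨hν0 n x, by simpa using hνsum n {x}⟩
  obtain ⟨π, -, hπ⟩ := (isCompact_univ_pi fun _ : α => isCompact_Icc (a := (0 : ℝ)) (b := 1))
    |>.ultrafilter_le_nhds ((Ultrafilter.of atTop).map ν)
      (le_principal_iff.2 (Filter.mem_map.2 (Filter.univ_mem' hνmem)))
  have hlimx (x : α) : Tendsto (fun n => ν n x) (Ultrafilter.of atTop : Ultrafilter ℕ) (𝓝 (π x)) :=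
    tendsto_pi_nhds.1 hπ x
  have hπ0 (x : α) : 0 ≤ π x := ge_of_tendsto' (hlimx x) fun n => hν0 n x
  exact ⟨Ultrafilter.of atTop, π, Ultrafilter.of_le atTop, hπ, hπ0, summable_of_sum_le hπ0
    fun u => le_of_tendsto' (tendsto_finsetSum u fun x _ => hlimx x) fun n => hνsum n u⟩

/-- A mass-preserving positive operator on finitely supported measures, which extends continuously
to all functions for pointwise convergence and satisfies a Foster–Lyapunov drift condition, has a
stationary probability distribution. -/
theorem exists_stationary_of_drift [Nonempty α]
    (T : (α →₀ ℝ) →ₗ[ℝ] (α →₀ ℝ)) (A : (α → ℝ) →ₗ[ℝ] (α → ℝ)) (hA : Continuous A)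
    (hTA : ∀ p : α →₀ ℝ, ⇑(T p) = A ⇑p) (hT : ∀ p : α →₀ ℝ, 0 ≤ p → 0 ≤ T p)
    (hmass : ∀ p : α →₀ ℝ, Finsupp.linearCombination ℝ (fun _ => (1 : ℝ)) (T p) =
      Finsupp.linearCombination ℝ (fun _ => (1 : ℝ)) p)
    (F : α → ℝ) (hF : ∀ x, 0 ≤ F x) (S : Finset α) {δ b : ℝ} (hδ : 0 < δ)
    (hdrift : ∀ p : α →₀ ℝ, 0 ≤ p → Finsupp.linearCombination ℝ F (T p) ≤
      Finsupp.linearCombination ℝ F p - δ * Finsupp.linearCombination ℝ (fun _ => (1 : ℝ)) p +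
        b * ∑ x ∈ S, p x) :
    ∃ p : α → ℝ, (∀ x, 0 ≤ p x) ∧ Summable p ∧ ∑' x, p x = 1 ∧ A p = p := by
  classical
  obtain ⟨x₀⟩ := ‹Nonempty α›
  set q : ℕ → α →₀ ℝ := fun n => (T ^ n) (Finsupp.single x₀ 1) with hq
  have hqs (n : ℕ) : q (n + 1) = T (q n) := by simp [hq, pow_succ']
  have hq0 (n : ℕ) : 0 ≤ q n := by
    induction n with
    | zero => simp [hq]
    | succ n ih => rw [hqs]; exact hT _ ih
  have hq1 (n : ℕ) : Finsupp.linearCombination ℝ (fun _ => (1 : ℝ)) (q n) = 1 := by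
    induction n with
    | zero => simp [hq]
    | succ n ih => rw [hqs, hmass, ih]
  have hqsum (n : ℕ) (u : Finset α) : ∑ x ∈ u, q n x ≤ 1 := by
    rw [← hq1 n, Finsupp.linearCombination_apply,
      Finsupp.sum_of_support_subset (s := u ∪ (q n).support) _ subset_union_right _ (by simp)]
    simp only [smul_eq_mul, mul_one]
    exact sum_le_sum_of_subset_of_nonneg subset_union_left fun x _ _ => hq0 n x
  have hqF (n : ℕ) : 0 ≤ Finsupp.linearCombination ℝ F (q n) := by
    rw [Finsupp.linearCombination_apply]
    exact Finset.sum_nonneg fun x _ => mul_nonneg (hq0 n x) (hF x)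
  have hdriftn (n : ℕ) : n * δ ≤ F x₀ + b * ∑ x ∈ S, ∑ i ∈ range n, q i x := by
    have key : Finsupp.linearCombination ℝ F (q n) ≤
        F x₀ - n * δ + b * ∑ x ∈ S, ∑ i ∈ range n, q i x := by
      induction n with
      | zero => simp [hq]
      | succ n ih =>
        have := hdrift (q n) (hq0 n)
        rw [← hqs, hq1] at this
        simp only [sum_range_succ, sum_add_distrib]
        push_cast
        linarith
    linarith [hqF n]
  obtain ⟨𝒰, π, h𝒰, hlim, hπ0, hsummable⟩ := exists_tendsto_cesaro (fun n => ⇑(q n)) hq0 hqsum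
  set ν : ℕ → α → ℝ := fun n => (n : ℝ)⁻¹ • ∑ i ∈ range n, ⇑(q i) with hν
  have hν_apply (n : ℕ) (x : α) : ν n x = (n : ℝ)⁻¹ * ∑ i ∈ range n, q i x := by
    simp [hν]
  have hlimx (x : α) : Tendsto (fun n => ν n x) 𝒰 (𝓝 (π x)) := tendsto_pi_nhds.1 hlim x
  have hinv : Tendsto (fun n : ℕ => (n : ℝ)⁻¹) 𝒰 (𝓝 0) :=
    tendsto_inv_atTop_nhds_zero_nat.mono_left h𝒰
  have hπS : δ ≤ b * ∑ x ∈ S, π x := by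
    have h1 : Tendsto (fun n : ℕ => (n : ℝ)⁻¹ * F x₀ + b * ∑ x ∈ S, ν n x) 𝒰
        (𝓝 (0 * F x₀ + b * ∑ x ∈ S, π x)) :=
      (hinv.mul_const _).add ((tendsto_finsetSum S fun x _ => hlimx x).const_mul b)
    rw [zero_mul, zero_add] at h1
    refine ge_of_tendsto h1 (h𝒰 ?_)
    filter_upwards [eventually_gt_atTop 0] with n hn
    have hn' : (0 : ℝ) < n := by exact_mod_cast hn
    have := mul_le_mul_of_nonneg_left (hdriftn n) (inv_nonneg.2 hn'.le)
    rw [inv_mul_cancel_left₀ hn'.ne'] at this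
    simp only [hν_apply, ← mul_sum]
    linarith
  have hpos : 0 < ∑' x, π x := by
    refine lt_of_lt_of_le ?_ (hsummable.sum_le_tsum S fun x _ => hπ0 x)
    refine lt_of_le_of_ne (sum_nonneg fun x _ => hπ0 x) fun h => ?_
    rw [← h] at hπS
    linarith
  have hfix : A π = π := by
    funext x
    have h1 : Tendsto (fun n => A (ν n) x - ν n x) 𝒰 (𝓝 (A π x - π x)) :=
      (((continuous_apply x).comp hA).continuousAt.tendsto.comp hlim).sub (hlimx x)
    have h2 (n : ℕ) : A (ν n) x - ν n x = (n : ℝ)⁻¹ * (q n x - q 0 x) := by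
      have h4 (i : ℕ) : A ⇑(q i) = ⇑(q (i + 1)) := by rw [hqs, hTA]
      simp only [hν]
      rw [map_smul, map_sum]
      simp only [h4, Pi.smul_apply, Finset.sum_apply, smul_eq_mul]
      rw [← mul_sub, ← sum_sub_distrib, sum_range_sub fun i => q i x]
    have hqx (n : ℕ) : 0 ≤ q n x ∧ q n x ≤ 1 := ⟨hq0 n x, by simpa using hqsum n {x}⟩
    have h5 : Tendsto (fun n => A (ν n) x - ν n x) 𝒰 (𝓝 0) := by
      refine squeeze_zero_norm (fun n => ?_) hinv
      rw [h2, norm_mul, norm_inv, Real.norm_natCast]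
      refine mul_le_of_le_one_right (by positivity) ?_
      rw [Real.norm_eq_abs, abs_le]
      constructor <;> linarith [hqx n, hqx 0]
    linarith [tendsto_nhds_unique h1 h5]
  refine ⟨fun x => (∑' x, π x)⁻¹ * π x, fun x => mul_nonneg (inv_nonneg.2 hpos.le) (hπ0 x),
    hsummable.mul_left _, ?_, ?_⟩
  · rw [tsum_mul_left, inv_mul_cancel₀ hpos.ne']
  · exact (map_smul A (∑' x, π x)⁻¹ π).trans (by rw [hfix]; rfl)

end StationaryDistribution

theorem update_add_one_eq_iff {ι : Type*} [DecidableEq ι] (x y : ι → ℕ) (k : ι) :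
    Function.update x k (x k + 1) = y ↔ 0 < y k ∧ x = Function.update y k (y k - 1) := by
  constructor
  · rintro rfl
    simp
  · rintro ⟨h, rfl⟩
    simp [Nat.sub_add_cancel h]

section BirthDeath

variable {ι : Type*} [Fintype ι] [DecidableEq ι]

/-- The law after one step, from state `x`, of the birth–death chain on `ι → ℕ` with birth rates
`lam` and death rates `μ`, uniformized with inverse rate `c`. -/
noncomputable def uniformizedKernel (lam : ι → ℝ) (μ : ι → (ι → ℕ) → ℝ) (c : ℝ) (x : ι → ℕ) :
    (ι → ℕ) →₀ ℝ :=
  Finsupp.single x 1 + c •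
    ((∑ k, lam k • (Finsupp.single (Function.update x k (x k + 1)) 1 - Finsupp.single x 1)) +
      ∑ k ∈ univ.filter (fun k => 0 < x k),
        μ k x • (Finsupp.single (Function.update x k (x k - 1)) 1 - Finsupp.single x 1))

/-- The action of the uniformized birth–death chain on (not necessarily finite) measures. -/
noncomputable def uniformizedDual (lam : ι → ℝ) (μ : ι → (ι → ℕ) → ℝ) (c : ℝ) :
    ((ι → ℕ) → ℝ) →ₗ[ℝ] ((ι → ℕ) → ℝ) where
  toFun p x := p x + c *
    (((∑ k ∈ univ.filter (fun k => 0 < x k), p (Function.update x k (x k - 1)) * lam k) +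
      ∑ k, p (Function.update x k (x k + 1)) * μ k (Function.update x k (x k + 1))) -
      p x * ((∑ k, lam k) + ∑ k ∈ univ.filter (fun k => 0 < x k), μ k x))
  map_add' p q := by
    funext x
    simp only [Pi.add_apply, add_mul, sum_add_distrib]
    ring
  map_smul' a p := by
    funext x
    simp only [Pi.smul_apply, smul_eq_mul, RingHom.id_apply, mul_assoc, ← mul_sum]
    ring

theorem uniformizedDual_apply (lam : ι → ℝ) (μ : ι → (ι → ℕ) → ℝ) (c : ℝ)
    (p : (ι → ℕ) → ℝ) (x : ι → ℕ) :
    uniformizedDual lam μ c p x = p x + c *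
      (((∑ k ∈ univ.filter (fun k => 0 < x k), p (Function.update x k (x k - 1)) * lam k) +
        ∑ k, p (Function.update x k (x k + 1)) * μ k (Function.update x k (x k + 1))) -
        p x * ((∑ k, lam k) + ∑ k ∈ univ.filter (fun k => 0 < x k), μ k x)) :=
  rfl

theorem continuous_uniformizedDual (lam : ι → ℝ) (μ : ι → (ι → ℕ) → ℝ) (c : ℝ) :
    Continuous (uniformizedDual lam μ c) := by
  refine continuous_pi fun x => ?_
  simp only [uniformizedDual_apply]
  fun_prop

theorem linearCombination_uniformizedKernel (lam : ι → ℝ) (μ : ι → (ι → ℕ) → ℝ) (c : ℝ)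
    (G : (ι → ℕ) → ℝ) (x : ι → ℕ) :
    Finsupp.linearCombination ℝ G (uniformizedKernel lam μ c x) = G x + c *
      ((∑ k, lam k * (G (Function.update x k (x k + 1)) - G x)) +
        ∑ k ∈ univ.filter (fun k => 0 < x k),
          μ k x * (G (Function.update x k (x k - 1)) - G x)) := by
  simp [uniformizedKernel, mul_add]

theorem uniformizedKernel_apply (lam : ι → ℝ) (μ : ι → (ι → ℕ) → ℝ) (c : ℝ) (x y : ι → ℕ) :
    uniformizedKernel lam μ c x y = uniformizedDual lam μ c (Finsupp.single x 1) y := by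
  have birth (k : ι) : (if Function.update x k (x k + 1) = y then lam k else 0) =
      if 0 < y k then (if x = Function.update y k (y k - 1) then lam k else 0) else 0 := by
    rw [← ite_and]
    simp only [update_add_one_eq_iff]
  have death (k : ι) :
      (if 0 < x k then (if Function.update x k (x k - 1) = y then μ k x else 0) else 0) =
      if x = Function.update y k (y k + 1) then μ k (Function.update y k (y k + 1)) else 0 := by
    rw [← ite_and]
    have : (0 < x k ∧ Function.update x k (x k - 1) = y) ↔ x = Function.update y k (y k + 1) := by
      rw [eq_comm (a := x), update_add_one_eq_iff, eq_comm (a := y)]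
    simp only [this]
    split_ifs with h
    · rw [← h]
    · rfl
  rw [uniformizedDual_apply]
  simp only [uniformizedKernel, Finsupp.add_apply, Finsupp.smul_apply, Finsupp.finsetSum_apply,
    Finsupp.sub_apply, Finsupp.single_apply, smul_eq_mul, mul_sub, sum_sub_distrib, mul_ite,
    mul_one, mul_zero, ite_mul, one_mul, zero_mul]
  simp only [sum_filter, birth, death]
  by_cases hxy : x = y
  · subst hxy
    simp
    ring
  · simp [hxy]

theorem uniformizedKernel_nonneg {lam : ι → ℝ} {μ : ι → (ι → ℕ) → ℝ} {c : ℝ} (hc : 0 ≤ c)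
    (hlam : ∀ k, 0 ≤ lam k) (hμ : ∀ k x, 0 ≤ μ k x) (x : ι → ℕ)
    (hx : c * ((∑ k, lam k) + ∑ k ∈ univ.filter (fun k => 0 < x k), μ k x) ≤ 1) :
    0 ≤ uniformizedKernel lam μ c x := by
  intro y
  have hs (z : ι → ℕ) : 0 ≤ (Finsupp.single x (1 : ℝ)) z :=
    (Finsupp.single_nonneg.2 zero_le_one : (0 : (ι → ℕ) →₀ ℝ) ≤ _) z
  rw [uniformizedKernel_apply, uniformizedDual_apply, Finsupp.coe_zero, Pi.zero_apply, mul_sub]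
  have h1 : 0 ≤ c *
      ((∑ k ∈ univ.filter (fun k => 0 < y k),
        (Finsupp.single x (1 : ℝ)) (Function.update y k (y k - 1)) * lam k) +
      ∑ k, (Finsupp.single x (1 : ℝ)) (Function.update y k (y k + 1)) *
        μ k (Function.update y k (y k + 1))) :=
    mul_nonneg hc (add_nonneg (sum_nonneg fun k _ => mul_nonneg (hs _) (hlam k))
      (sum_nonneg fun k _ => mul_nonneg (hs _) (hμ k _)))
  by_cases hxy : x = y
  · subst hxy
    rw [Finsupp.single_eq_same] at *
    linarith
  · have : (Finsupp.single x (1 : ℝ)) y = 0 := by simp [hxy]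
    rw [this] at *
    linarith

theorem coe_linearCombination_uniformizedKernel (lam : ι → ℝ) (μ : ι → (ι → ℕ) → ℝ) (c : ℝ)
    (p : (ι → ℕ) →₀ ℝ) :
    ⇑(Finsupp.linearCombination ℝ (uniformizedKernel lam μ c) p) = uniformizedDual lam μ c ⇑p := by
  induction p using Finsupp.induction_linear with
  | zero => simp
  | add p q hp hq => simp [hp, hq]
  | single x a =>
    have : ⇑(Finsupp.single x a) = a • ⇑(Finsupp.single x (1 : ℝ)) := by
      rw [← Finsupp.coe_smul]; simp
    rw [this, map_smul, Finsupp.linearCombination_single, Finsupp.coe_smul]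
    congr 1
    funext y
    exact uniformizedKernel_apply lam μ c x y

end BirthDeath

/-- Foster–Lyapunov criterion: an irreducible continuous-time Markov chain on
`ℕ^K` with arrival rates `λ_k` and bounded departure rates `μ_k(x)` admitting a
nonnegative Lyapunov function with drift at most `-δ` outside a finite set is
ergodic, i.e. possesses a stationary probability distribution. -/
theorem foster_lyapunov_ergodicity (K : ℕ) (hK : 0 < K)
    (lam : Fin K → ℝ) (hlam : ∀ k, 0 < lam k)
    (μ : Fin K → (Fin K → ℕ) → ℝ) (C : ℝ)
    (hμ : ∀ k x, 0 ≤ μ k x ∧ μ k x ≤ C)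
    -- one-step transitions with positive rate
    (step : (Fin K → ℕ) → (Fin K → ℕ) → Prop)
    (hstep : ∀ x y, step x y ↔
      ((∃ k, y = Function.update x k (x k + 1)) ∨
       (∃ k, 0 < x k ∧ 0 < μ k x ∧ y = Function.update x k (x k - 1))))
    -- irreducibility
    (hirr : ∀ x y : Fin K → ℕ, Relation.ReflTransGen step x y)
    -- Lyapunov function with negative drift outside a finite set
    (F : (Fin K → ℕ) → ℝ) (hFnn : ∀ x, 0 ≤ F x)
    (δ : ℝ) (hδ : 0 < δ) (S : Finset (Fin K → ℕ))
    (hdrift : ∀ x ∉ S,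
      (∑ k, lam k * (F (Function.update x k (x k + 1)) - F x)) +
      (∑ k ∈ univ.filter (fun k => 0 < x k),
        μ k x * (F (Function.update x k (x k - 1)) - F x)) ≤ -δ) :
    -- ergodicity: existence of a stationary probability distribution
    ∃ p : (Fin K → ℕ) → ℝ, (∀ x, 0 ≤ p x) ∧ Summable p ∧ (∑' x, p x) = 1 ∧
      ∀ x : Fin K → ℕ,
        p x * ((∑ k, lam k) + ∑ k ∈ univ.filter (fun k => 0 < x k), μ k x) =
        (∑ k ∈ univ.filter (fun k => 0 < x k),
          p (Function.update x k (x k - 1)) * lam k) +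
        ∑ k, p (Function.update x k (x k + 1)) *
          μ k (Function.update x k (x k + 1)) := by
  classical
  have hC : 0 ≤ C := (hμ ⟨0, hK⟩ 0).1.trans (hμ ⟨0, hK⟩ 0).2
  have hlam0 : 0 ≤ ∑ k, lam k := sum_nonneg fun k _ => (hlam k).le
  obtain ⟨c, hc, hrate⟩ : ∃ c : ℝ, 0 < c ∧ ∀ x : Fin K → ℕ,
      c * ((∑ k, lam k) + ∑ k ∈ univ.filter (fun k => 0 < x k), μ k x) ≤ 1 := by
    have hpos : 0 < (∑ k, lam k) + K * C + 1 := by positivity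
    refine ⟨((∑ k, lam k) + K * C + 1)⁻¹, inv_pos.2 hpos, fun x => ?_⟩
    rw [inv_mul_le_one₀ hpos]
    have : ∑ k ∈ univ.filter (fun k => 0 < x k), μ k x ≤ K * C :=
      calc ∑ k ∈ univ.filter (fun k => 0 < x k), μ k x ≤ ∑ k, μ k x :=
            sum_le_sum_of_subset_of_nonneg (filter_subset _ _) fun k _ _ => (hμ k x).1
        _ ≤ ∑ _k : Fin K, C := sum_le_sum fun k _ => (hμ k x).2
        _ = K * C := by simp
    linarith
  set T := Finsupp.linearCombination ℝ (uniformizedKernel lam μ c) with hT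
  have hcomp (G : (Fin K → ℕ) → ℝ) (p : (Fin K → ℕ) →₀ ℝ) :
      Finsupp.linearCombination ℝ G (T p) = Finsupp.linearCombination ℝ
        (fun x => Finsupp.linearCombination ℝ G (uniformizedKernel lam μ c x)) p := by
    rw [hT, Finsupp.linearCombination_linearCombination]
  set D : (Fin K → ℕ) → ℝ := fun x =>
    Finsupp.linearCombination ℝ F (uniformizedKernel lam μ c x) - F x + c * δ with hD
  have hDS (x) (hx : x ∉ S) : D x ≤ 0 := by
    simp only [hD, linearCombination_uniformizedKernel]
    linarith [mul_le_mul_of_nonneg_left (hdrift x hx) hc.le]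
  obtain ⟨p, hp0, hps, hp1, hpA⟩ := exists_stationary_of_drift T (uniformizedDual lam μ c)
    (continuous_uniformizedDual lam μ c) (coe_linearCombination_uniformizedKernel lam μ c)
    (fun p hp => by
      rw [hT, Finsupp.linearCombination_apply]
      exact sum_nonneg fun x _ => smul_nonneg (hp x) (uniformizedKernel_nonneg hc.le
        (fun k => (hlam k).le) (fun k x => (hμ k x).1) x (hrate x)))
    (fun p => by simp [hcomp, linearCombination_uniformizedKernel])
    F hFnn S (δ := c * δ) (b := ∑ x ∈ S, |D x|) (mul_pos hc hδ) (fun p hp => by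
      have hle : ∑ x ∈ p.support, p x * D x ≤ (∑ x ∈ S, |D x|) * ∑ x ∈ S, p x :=
        calc ∑ x ∈ p.support, p x * D x
            ≤ ∑ x ∈ p.support, if x ∈ S then p x * ∑ z ∈ S, |D z| else 0 := by
              refine sum_le_sum fun x _ => ?_
              split_ifs with hx
              · exact mul_le_mul_of_nonneg_left ((le_abs_self _).trans
                  (single_le_sum (f := fun z => |D z|) (fun z _ => abs_nonneg _) hx)) (hp x)
              · exact mul_nonpos_of_nonneg_of_nonpos (hp x) (hDS x hx)
          _ ≤ ∑ x ∈ S, p x * ∑ z ∈ S, |D z| := by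
              rw [← sum_filter]
              refine sum_le_sum_of_subset_of_nonneg (fun x hx => (mem_filter.1 hx).2)
                fun x _ _ => mul_nonneg (hp x) (sum_nonneg fun z _ => abs_nonneg _)
          _ = _ := by rw [← sum_mul, mul_comm]
      have hsplit : ∑ x ∈ p.support, p x * D x = Finsupp.linearCombination ℝ F (T p) -
          Finsupp.linearCombination ℝ F p +
          c * δ * Finsupp.linearCombination ℝ (fun _ => (1 : ℝ)) p := by
        rw [hcomp]
        simp only [hD, Finsupp.linearCombination_apply, Finsupp.sum, smul_eq_mul, mul_add,
          mul_sub, sum_add_distrib, sum_sub_distrib, mul_one, ← sum_mul]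
        ring
      linarith)
  refine ⟨p, hp0, hps, hp1, fun x => ?_⟩
  have hx := congrFun hpA x
  rw [uniformizedDual_apply, add_eq_left, mul_eq_zero] at hx
  exact (sub_eq_zero.1 (hx.resolve_left hc.ne')).symm
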